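/- arXiv:math/0002202 — 4 statements merged into one kernel-verified Lean document; each statement's English description precedes it below -/
import Mathlib

section
/- Let W be an open subset of ℝⁿ⁻¹, I an open interval containing 0, U = W × I ⊆ ℝⁿ, and g : U → Matrix (Fin n) (Fin n) ℝ a C^∞ map such that g(x) is symmetric and positive definite for every x ∈ U, with Christoffel symbols Γᵏᵢⱼ(x) = (1/2) Σₛ (g(x)⁻¹)ₖₛ (∂ᵢ gₛⱼ(x) + ∂ⱼ gᵢₛ(x) − ∂ₛ gᵢⱼ(x)). Assume Γᵏₙₙ(x) = 0 for all x ∈ U and all k, that gₙₙ(u,0) = 1 for all u ∈ W, and that gₛₙ(u,0) = 0 for all u ∈ W and all s < n. Then gₙₙ ≡ 1 on U and gₛₙ ≡ 0 on U for all s < n; that is, in semigeodesic coordinates every hypersurface xⁿ = const is orthogonal to the geodesic lines implementing the shift, so geodesic shift is a normal shift of hypersurfaces. -/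
/-- Christoffel symbols of a metric `g` on an open subset of `ℝⁿ`. -/
noncomputable def christoffel {n : ℕ} (g : (Fin n → ℝ) → Matrix (Fin n) (Fin n) ℝ)
    (x : Fin n → ℝ) (k i j : Fin n) : ℝ :=
  (1 / 2) * ∑ s : Fin n, (g x)⁻¹ k s *
    (fderiv ℝ (fun y => g y s j) x (Pi.single i 1) +
     fderiv ℝ (fun y => g y i s) x (Pi.single j 1) -
     fderiv ℝ (fun y => g y i j) x (Pi.single s 1))

/-- The partial derivatives of a metric that vanish together with all `Γᵏⱼⱼ` at a point. -/
theorem fderiv_add_fderiv_sub_eq_zero_of_christoffel {n : ℕ}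
    {g : (Fin n → ℝ) → Matrix (Fin n) (Fin n) ℝ} {x : Fin n → ℝ} {i j : Fin n}
    (hg : IsUnit (g x)) (h : ∀ k, christoffel g x k i j = 0) (s : Fin n) :
    fderiv ℝ (fun y => g y s j) x (Pi.single i 1) +
      fderiv ℝ (fun y => g y i s) x (Pi.single j 1) -
      fderiv ℝ (fun y => g y i j) x (Pi.single s 1) = 0 := by
  set v : Fin n → ℝ := fun s =>
    fderiv ℝ (fun y => g y s j) x (Pi.single i 1) +
      fderiv ℝ (fun y => g y i s) x (Pi.single j 1) -
      fderiv ℝ (fun y => g y i j) x (Pi.single s 1) with hv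
  have hmul : (g x)⁻¹.mulVec v = 0 := by
    ext k
    have hk := h k
    unfold christoffel at hk
    simpa [Matrix.mulVec, dotProduct, hv] using hk
  have hinj := Matrix.mulVec_injective_of_isUnit ((Matrix.isUnit_nonsing_inv_iff).2 hg)
  have hv0 : v = 0 := hinj (by simpa using hmul)
  exact congrFun hv0 s

/-- A function on `W × (a, b)` with vanishing last partial derivative is determined by its values
on the slice where the last coordinate is zero. -/
theorem eq_of_fderiv_last_eq_zero {n : ℕ} {W : Set (Fin n → ℝ)} {a b : ℝ} (ha : a < 0)
    (hb : 0 < b) {U : Set (Fin (n + 1) → ℝ)}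
    (hU : U = {x : Fin (n + 1) → ℝ | Fin.init x ∈ W ∧ x (Fin.last n) ∈ Set.Ioo a b})
    {f : (Fin (n + 1) → ℝ) → ℝ} (hf : ∀ x ∈ U, DifferentiableAt ℝ f x)
    (hf' : ∀ x ∈ U, fderiv ℝ f x (Pi.single (Fin.last n) 1) = 0) {c : ℝ}
    (h0 : ∀ u ∈ W, f (Fin.snoc u (0 : ℝ)) = c) {x : Fin (n + 1) → ℝ} (hx : x ∈ U) :
    f x = c := by
  have hx' := hx
  rw [hU] at hx'
  obtain ⟨hxW, hxI⟩ := hx'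
  have hmem : ∀ t ∈ Set.Ioo a b, Function.update x (Fin.last n) t ∈ U := by
    intro t ht
    rw [hU]
    exact ⟨by rwa [Fin.init_update_last], by simpa using ht⟩
  have hderiv : ∀ t ∈ Set.Ioo a b,
      HasDerivAt (fun t => f (Function.update x (Fin.last n) t)) 0 t := by
    intro t ht
    have h := (hf _ (hmem t ht)).hasFDerivAt.comp_hasDerivAt t
      (hasDerivAt_update x (Fin.last n) t)
    rwa [hf' _ (hmem t ht)] at h
  have hconst := isOpen_Ioo.is_const_of_deriv_eq_zero isPreconnected_Ioo
    (fun t ht => (hderiv t ht).differentiableAt.differentiableWithinAt)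
    (fun t ht => (hderiv t ht).deriv) hxI (Set.mem_Ioo.2 ⟨ha, hb⟩)
  have hslice : Function.update x (Fin.last n) 0 = Fin.snoc (Fin.init x) (0 : ℝ) := by
    ext i
    refine Fin.lastCases ?_ (fun i => ?_) i
    · simp
    · simp [Fin.init, (Fin.castSucc_lt_last i).ne]
  simp only [Function.update_eq_self] at hconst
  rw [hconst, hslice, h0 _ hxW]

/-- On `U = W × I` (with `I` an open interval around `0`), if `Γᵏₙₙ ≡ 0` on `U`, `gₙₙ = 1` on the
slice `xⁿ = 0` and `gₛₙ = 0` there for `s < n`, then `gₙₙ ≡ 1` and `gₛₙ ≡ 0` on the whole of `U`: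
geodesic shift is a normal shift of hypersurfaces.  The ambient space is `ℝ^(n+1)`, the last
coordinate playing the role of the shift parameter. -/
theorem geodesic_shift_is_normal {n : ℕ}
    (W : Set (Fin n → ℝ)) (hW : IsOpen W)
    (a b : ℝ) (ha : a < 0) (hb : 0 < b)
    (U : Set (Fin (n + 1) → ℝ))
    (hUdef : U = {x : Fin (n + 1) → ℝ | Fin.init x ∈ W ∧ x (Fin.last n) ∈ Set.Ioo a b})
    (g : (Fin (n + 1) → ℝ) → Matrix (Fin (n + 1)) (Fin (n + 1)) ℝ)
    (hsmooth : ∀ i j : Fin (n + 1), ContDiffOn ℝ (⊤ : ℕ∞) (fun x => g x i j) U)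
    (hsym : ∀ x ∈ U, (g x).IsSymm)
    (hpos : ∀ x ∈ U, (g x).PosDef)
    (hΓ : ∀ x ∈ U, ∀ k : Fin (n + 1),
      christoffel g x k (Fin.last n) (Fin.last n) = 0)
    (hgnn0 : ∀ u ∈ W, g (Fin.snoc u (0 : ℝ)) (Fin.last n) (Fin.last n) = 1)
    (hgsn0 : ∀ u ∈ W, ∀ s : Fin n, g (Fin.snoc u (0 : ℝ)) s.castSucc (Fin.last n) = 0) :
    ∀ x ∈ U, g x (Fin.last n) (Fin.last n) = 1 ∧
      ∀ s : Fin n, g x s.castSucc (Fin.last n) = 0 := by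
  have hUo : IsOpen U := by
    rw [hUdef]
    exact (hW.preimage (continuous_pi fun i => continuous_apply i.castSucc)).inter
      (isOpen_Ioo.preimage (continuous_apply (Fin.last n)))
  have hdiff : ∀ i j, ∀ x ∈ U, DifferentiableAt ℝ (fun y => g y i j) x := fun i j x hx =>
    ((hsmooth i j).contDiffAt (hUo.mem_nhds hx)).differentiableAt (by simp)
  have hzero : ∀ x ∈ U, ∀ s, 2 * fderiv ℝ (fun y => g y s (Fin.last n)) x
      (Pi.single (Fin.last n) 1) =
      fderiv ℝ (fun y => g y (Fin.last n) (Fin.last n)) x (Pi.single s 1) := by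
    intro x hx s
    have h := fderiv_add_fderiv_sub_eq_zero_of_christoffel (hpos x hx).isUnit (hΓ x hx) s
    have hswap : (fun y => g y (Fin.last n) s) =ᶠ[nhds x] fun y => g y s (Fin.last n) := by
      filter_upwards [hUo.mem_nhds hx] with y hy
      exact (hsym y hy).apply s (Fin.last n)
    rw [hswap.fderiv_eq] at h
    linarith
  have hnn : ∀ x ∈ U, g x (Fin.last n) (Fin.last n) = 1 := fun x hx =>
    eq_of_fderiv_last_eq_zero ha hb hUdef (hdiff _ _)
      (fun y hy => by linarith [hzero y hy (Fin.last n)]) hgnn0 hx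
  refine fun x hx => ⟨hnn x hx, fun s => ?_⟩
  refine eq_of_fderiv_last_eq_zero ha hb hUdef (hdiff _ _) (fun y hy => ?_)
    (fun u hu => hgsn0 u hu s) hx
  have hloc : (fun z => g z (Fin.last n) (Fin.last n)) =ᶠ[nhds y] fun _ => (1 : ℝ) := by
    filter_upwards [hUo.mem_nhds hy] with z hz using hnn z hz
  have h := hzero y hy s.castSucc
  rw [hloc.fderiv_eq] at h
  simpa using h
end

section
/- (Theorem 8.1, sufficiency.) Let m ≥ 1, let D ⊆ ℝᵐ × ℝ be open, and let ψ = (ψ₁,…,ψₘ) : D → ℝᵐ be C^∞. Assume the compatibility conditions: for every (u,ν) ∈ D and all indices 1 ≤ k, r ≤ m, ∂ψₖ/∂uʳ(u,ν) + (∂ψₖ/∂ν)(u,ν) · ψᵣ(u,ν) = ∂ψᵣ/∂uᵏ(u,ν) + (∂ψᵣ/∂ν)(u,ν) · ψₖ(u,ν). Then for every point (u₀,ν₀) ∈ D there exist an open neighborhood W ⊆ ℝᵐ of u₀ and a C^∞ function ν : W → ℝ such that ν(u₀) = ν₀, (u, ν(u)) ∈ D for all u ∈ W, and ∂ν/∂uᵏ(u)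 = ψₖ(u, ν(u)) for all u ∈ W and all k = 1,…,m. -/
open Metric Set Filter Topology NNReal

/-- The **Picard-Lindelöf theorem**, together with the fact that the solution stays in the closed
ball in which the assumptions on the vector field are made. -/
theorem IsPicardLindelof.exists_mem_closedBall_hasDerivWithinAt
    {E : Type*} [NormedAddCommGroup E] [NormedSpace ℝ E] [CompleteSpace E]
    {f : ℝ → E → E} {tmin tmax : ℝ} {t₀ : Icc tmin tmax} {x₀ x : E} {a r L K : ℝ≥0}
    (hf : IsPicardLindelof f t₀ x₀ a r L K) (hx : x ∈ closedBall x₀ r) :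
    ∃ α : ℝ → E, α t₀ = x ∧ (∀ t, α t ∈ closedBall x₀ a) ∧
      ∀ t ∈ Icc tmin tmax, HasDerivWithinAt α (f t (α t)) (Icc tmin tmax) t := by
  obtain ⟨α, hα⟩ := ODE.FunSpace.exists_isFixedPt_next hf hx
  refine ⟨α.compProj, by rw [ODE.FunSpace.compProj_val, ← hα, ODE.FunSpace.next_apply₀],
    fun t => α.compProj_mem_closedBall hf.mul_max_le, fun t ht ↦ ?_⟩
  apply ODE.hasDerivWithinAt_picard_Icc t₀.2 hf.continuousOn_uncurry
    α.continuous_compProj.continuousOn (fun _ ht' ↦ α.compProj_mem_closedBall hf.mul_max_le)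
    x ht |>.congr_of_mem _ ht
  intro t' ht'
  nth_rw 1 [← hα]
  rw [ODE.FunSpace.compProj_of_mem ht', ODE.FunSpace.next_apply]

/-- A `C²` map has a second order Taylor estimate which is uniform near a given point. -/
theorem ContDiffAt.eventually_norm_sub_sub_fderiv_le
    {E F : Type*} [NormedAddCommGroup E] [NormedSpace ℝ E] [NormedAddCommGroup F] [NormedSpace ℝ F]
    {f : E → F} {p : E} (hf : ContDiffAt ℝ 2 f p) :
    ∃ C : ℝ≥0, ∃ ρ > 0, ∀ q ∈ closedBall p ρ, ∀ q' ∈ closedBall p ρ,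
      ‖f q' - f q - fderiv ℝ f q (q' - q)‖ ≤ C * ‖q' - q‖ ^ 2 := by
  obtain ⟨C, t, ht, hC⟩ :=
    (hf.fderiv_right (m := 1) (by norm_num)).exists_lipschitzOnWith
  have hd : ∀ᶠ q in 𝓝 p, DifferentiableAt ℝ f q :=
    (hf.eventually (by simp)).mono fun q hq => hq.differentiableAt (by simp)
  obtain ⟨ρ, hρ, hball⟩ := nhds_basis_closedBall.mem_iff.1 (inter_mem ht hd)
  refine ⟨C, ρ, hρ, fun q hq q' hq' => ?_⟩
  have hseg : segment ℝ q q' ⊆ closedBall p ρ := (convex_closedBall p ρ).segment_subset hq hq'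
  have key := (convex_segment q q').norm_image_sub_le_of_norm_hasFDerivWithin_le'
    (f := f) (f' := fderiv ℝ f) (φ := fderiv ℝ f q) (C := C * ‖q' - q‖)
    (fun z hz => (hball (hseg hz)).2.hasFDerivAt.hasFDerivWithinAt)
    (fun z hz => ?_) (left_mem_segment ℝ q q') (right_mem_segment ℝ q q')
  · rwa [mul_assoc, ← sq] at key
  · refine (hC.norm_sub_le (hball (hseg hz)).1 (hball hq).1).trans ?_
    gcongr
    exact norm_sub_le_of_mem_segment hz

/-- **Frobenius theorem** for total differential equations: if `Ψ` is `C²` and satisfies the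
integrability condition near `p₀`, then `Dν = Ψ (u, ν)` has a local solution through `p₀`. -/
theorem exists_eventually_hasFDerivAt_of_integrable
    {E F : Type*} [NormedAddCommGroup E] [NormedSpace ℝ E] [NormedAddCommGroup F] [NormedSpace ℝ F]
    [CompleteSpace F] {Ψ : E × F → E →L[ℝ] F} {p₀ : E × F} (hΨ : ContDiffAt ℝ 2 Ψ p₀)
    (hint : ∀ᶠ p in 𝓝 p₀, ∀ v h : E,
      fderiv ℝ Ψ p (v, Ψ p v) h = fderiv ℝ Ψ p (h, Ψ p h) v) :
    ∃ ν : E → F, ν p₀.1 = p₀.2 ∧ ∀ᶠ u in 𝓝 p₀.1, HasFDerivAt ν (Ψ (u, ν u)) u := by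
  obtain ⟨u₀, ν₀⟩ := p₀
  obtain ⟨C, ρ₁, hρ₁, hC⟩ := hΨ.eventually_norm_sub_sub_fderiv_le
  obtain ⟨M, hM1, hM⟩ : ∃ M : ℝ≥0, 1 ≤ M ∧ ∀ᶠ p in 𝓝 (u₀, ν₀), ‖Ψ p‖ ≤ M := by
    refine ⟨‖Ψ (u₀, ν₀)‖₊ + 1, by simp, ?_⟩
    filter_upwards [hΨ.continuousAt.norm.eventually_lt_const (lt_add_one _)] with p hp
    simpa using hp.le
  obtain ⟨K, hK⟩ : ∃ K : ℝ≥0, ∀ᶠ p in 𝓝 (u₀, ν₀), ‖fderiv ℝ Ψ p‖ ≤ K := by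
    refine ⟨‖fderiv ℝ Ψ (u₀, ν₀)‖₊ + 1, ?_⟩
    filter_upwards [(hΨ.fderiv_right (m := 0) (by norm_num)).continuousAt.norm.eventually_lt_const
      (lt_add_one _)] with p hp
    simpa using hp.le
  have hd : ∀ᶠ q in 𝓝 (u₀, ν₀), DifferentiableAt ℝ Ψ q :=
    (hΨ.eventually (by simp)).mono fun q hq => hq.differentiableAt (by simp)
  obtain ⟨ρ₂, hρ₂, hball⟩ := nhds_basis_closedBall.mem_iff.1 (hint.and (hM.and (hK.and hd)))
  obtain ⟨ρ, hρ, hρle⟩ : ∃ ρ : ℝ≥0, 0 < ρ ∧ (ρ : ℝ) ≤ min ρ₁ ρ₂ :=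
    ⟨(min ρ₁ ρ₂).toNNReal, Real.toNNReal_pos.2 (lt_min hρ₁ hρ₂),
      (Real.coe_toNNReal _ (lt_min hρ₁ hρ₂).le).le⟩
  replace hC : ∀ q ∈ closedBall (u₀, ν₀) ρ, ∀ q' ∈ closedBall (u₀, ν₀) ρ,
      ‖Ψ q' - Ψ q - fderiv ℝ Ψ q (q' - q)‖ ≤ C * ‖q' - q‖ ^ 2 := fun q hq q' hq' =>
    hC q (closedBall_subset_closedBall (hρle.trans (min_le_left _ _)) hq)
      q' (closedBall_subset_closedBall (hρle.trans (min_le_left _ _)) hq')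
  replace hball : ∀ q ∈ closedBall (u₀, ν₀) ρ, _ := fun q hq =>
    hball (closedBall_subset_closedBall (hρle.trans (min_le_right _ _)) hq)
  replace hint := fun q hq => (hball q hq).1
  replace hM := fun q hq => (hball q hq).2.1
  replace hK := fun q hq => (hball q hq).2.2.1
  replace hd := fun q hq => (hball q hq).2.2.2
  clear hball hρle
  obtain ⟨δ, hδ, hMδ, hKδ⟩ : ∃ δ : ℝ≥0, 0 < δ ∧ M * δ ≤ ρ / 4 ∧ K * δ ≤ 1 := by
    have hM0 : 0 < M := one_pos.trans_le hM1
    refine ⟨min (ρ / 4 / M) (1 / (K + 1)), by positivity, ?_, ?_⟩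
    · calc M * min (ρ / 4 / M) (1 / (K + 1)) ≤ M * (ρ / 4 / M) := by gcongr; exact min_le_left _ _
        _ = ρ / 4 := by field_simp
    · calc K * min (ρ / 4 / M) (1 / (K + 1)) ≤ (K + 1) * (1 / (K + 1)) := by
            gcongr
            · simp
            · exact min_le_right _ _
        _ = 1 := by field_simp
  have hMδ' : (M : ℝ) * δ ≤ ρ / 4 := by exact_mod_cast hMδ
  have hKδ' : (K : ℝ) * δ ≤ 1 := by exact_mod_cast hKδ
  have hM1' : (1 : ℝ) ≤ M := by exact_mod_cast hM1
  have hδρ : (δ : ℝ) ≤ ρ := by nlinarith [δ.coe_nonneg, ρ.coe_nonneg]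
  have hmem : ∀ v : E, ‖v‖ < δ → ∀ t ∈ Icc (0 : ℝ) 1, ∀ x ∈ closedBall ν₀ (ρ : ℝ),
      (u₀ + t • v, x) ∈ closedBall (u₀, ν₀) (ρ : ℝ) := by
    intro v hv t ht x hx
    rw [← closedBall_prod_same]
    refine ⟨?_, hx⟩
    rw [mem_closedBall_iff_norm, add_sub_cancel_left, norm_smul, Real.norm_of_nonneg ht.1]
    nlinarith [norm_nonneg v, ht.2]
  -- the field along a ray is Lipschitz in the space variable
  have hlip : ∀ v : E, ‖v‖ < δ → ∀ t ∈ Icc (0 : ℝ) 1,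
      LipschitzOnWith 1 (fun x => Ψ (u₀ + t • v, x) v) (closedBall ν₀ ρ) := by
    intro v hv t ht
    refine LipschitzOnWith.of_dist_le_mul fun x hx y hy => ?_
    have h := (convex_closedBall (u₀, ν₀) (ρ : ℝ)).norm_image_sub_le_of_norm_fderiv_le
      hd hK (hmem v hv t ht y hy) (hmem v hv t ht x hx)
    rw [dist_eq_norm, ← _root_.sub_apply, dist_eq_norm]
    refine (ContinuousLinearMap.le_opNorm _ _).trans ?_
    have e : ‖((u₀ + t • v, x) : E × F) - (u₀ + t • v, y)‖ = ‖x - y‖ := by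
      simp [Prod.norm_def]
    rw [e] at h
    calc _ ≤ K * ‖x - y‖ * δ := by gcongr
      _ = (K * δ) * ‖x - y‖ := by ring
      _ ≤ _ := by gcongr; simpa using hKδ'
  have hsol : ∀ v : E, ∃ z : ℝ → F, ‖v‖ < δ → z 0 = ν₀ ∧
      (∀ t, z t ∈ closedBall ν₀ (ρ / 2 : ℝ)) ∧
      ∀ t ∈ Icc (0 : ℝ) 1, HasDerivWithinAt z (Ψ (u₀ + t • v, z t) v) (Icc 0 1) t := by
    intro v
    by_cases hv : ‖v‖ < δ
    swap
    · exact ⟨0, fun h => absurd h hv⟩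
    have hsub : closedBall ν₀ (ρ / 2 : ℝ) ⊆ closedBall ν₀ ρ :=
      closedBall_subset_closedBall (by linarith [ρ.coe_nonneg])
    have hPL : IsPicardLindelof (fun t x => Ψ (u₀ + t • v, x) v)
        (⟨0, by simp⟩ : Icc (0 : ℝ) 1) ν₀ (ρ / 2) 0 (M * δ) 1 := by
      refine ⟨fun t ht => (hlip v hv t ht).mono (by simpa using hsub), fun x hx t ht => ?_,
        fun t ht x hx => ?_, ?_⟩
      · have hc := (hd _ (hmem v hv t ht x (hsub (by simpa using hx)))).continuousAt
        have : ContinuousAt (fun t : ℝ => Ψ (u₀ + t • v, x)) t :=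
          ContinuousAt.comp (f := fun t : ℝ => (u₀ + t • v, x)) hc (by fun_prop)
        exact (this.clm_apply continuousAt_const).continuousWithinAt
      · refine (ContinuousLinearMap.le_opNorm _ _).trans ?_
        push_cast
        have := hM _ (hmem v hv t ht x (hsub (by simpa using hx)))
        gcongr
      · simp only [NNReal.coe_mul, NNReal.coe_div, NNReal.coe_zero, NNReal.coe_ofNat]
        simp
        linarith [ρ.coe_nonneg]
    obtain ⟨z, hz0, hzb, hz⟩ := hPL.exists_mem_closedBall_hasDerivWithinAt
      (mem_closedBall_self le_rfl)
    exact ⟨z, fun _ => ⟨hz0, by simpa using hzb, hz⟩⟩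
  choose z hz using hsol
  -- comparison of neighbouring rays
  have hest : ∀ v h : E, ‖v‖ < δ → ‖v + h‖ < δ →
      ‖z (v + h) 1 - z v 1 - Ψ (u₀ + v, z v 1) h‖ ≤
        (C * M ^ 2 * δ + K * M) * (Real.exp 1 - 1) * ‖h‖ ^ 2 := by
    intro v h hv hvh
    obtain ⟨hz0, hzb, hzd⟩ := hz v hv
    obtain ⟨hw0, hwb, hwd⟩ := hz (v + h) hvh
    have hsub : closedBall ν₀ (ρ / 2 : ℝ) ⊆ closedBall ν₀ ρ :=
      closedBall_subset_closedBall (by linarith [ρ.coe_nonneg])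
    have hh : ‖h‖ ≤ 2 * δ := by
      have := norm_sub_le (v + h) v
      rw [add_sub_cancel_left] at this
      linarith
    have hq : ∀ t ∈ Icc (0 : ℝ) 1, (u₀ + t • v, z v t) ∈ closedBall (u₀, ν₀) (ρ : ℝ) :=
      fun t ht => hmem v hv t ht _ (hsub (hzb t))
    have hAh : ∀ t ∈ Icc (0 : ℝ) 1, ‖Ψ (u₀ + t • v, z v t) h‖ ≤ M * ‖h‖ := fun t ht =>
      (ContinuousLinearMap.le_opNorm _ _).trans (by have := hM _ (hq t ht); gcongr)
    have htAh : ∀ t ∈ Icc (0 : ℝ) 1, ‖t • Ψ (u₀ + t • v, z v t) h‖ ≤ M * ‖h‖ := fun t ht => by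
      rw [norm_smul, Real.norm_of_nonneg ht.1]
      exact (mul_le_of_le_one_left (norm_nonneg _) ht.2).trans (hAh t ht)
    set y : ℝ → F := fun t => z v t + t • Ψ (u₀ + t • v, z v t) h with hy
    have hyb : ∀ t ∈ Icc (0 : ℝ) 1, y t ∈ closedBall ν₀ (ρ : ℝ) := by
      intro t ht
      have h1 := mem_closedBall_iff_norm.1 (hzb t)
      rw [mem_closedBall_iff_norm, hy]
      have h2 : (M : ℝ) * ‖h‖ ≤ ρ / 2 := by nlinarith
      calc _ = ‖(z v t - ν₀) + t • Ψ (u₀ + t • v, z v t) h‖ := by congr 1; simp only; abel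
        _ ≤ _ := norm_add_le _ _
        _ ≤ ρ := by linarith [htAh t ht]
    have hyd : ∀ t ∈ Icc (0 : ℝ) 1, HasDerivWithinAt y (Ψ (u₀ + t • v, z v t) v +
        (t • fderiv ℝ Ψ (u₀ + t • v, z v t) (v, Ψ (u₀ + t • v, z v t) v) h
          + Ψ (u₀ + t • v, z v t) h)) (Icc 0 1) t := by
      intro t ht
      have h1 : HasDerivWithinAt (fun t : ℝ => u₀ + t • v) v (Icc 0 1) t := by
        simpa using (((hasDerivAt_id t).smul_const v).const_add u₀).hasDerivWithinAt
      have h2 : HasDerivWithinAt (fun t : ℝ => Ψ (u₀ + t • v, z v t))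
          (fderiv ℝ Ψ (u₀ + t • v, z v t) (v, Ψ (u₀ + t • v, z v t) v)) (Icc 0 1) t :=
        HasFDerivAt.comp_hasDerivWithinAt (f := fun t : ℝ => (u₀ + t • v, z v t)) t
          (hd _ (hq t ht)).hasFDerivAt (h1.prodMk (hzd t ht))
      have h3 := (hasDerivWithinAt_id t (Icc 0 1)).smul
        (h2.clm_apply (hasDerivWithinAt_const t (Icc 0 1) h))
      have h4 : HasDerivWithinAt y _ (Icc 0 1) t := (hzd t ht).add h3
      simpa using h4
    have hyerr : ∀ t ∈ Icc (0 : ℝ) 1, dist (Ψ (u₀ + t • v, z v t) v +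
        (t • fderiv ℝ Ψ (u₀ + t • v, z v t) (v, Ψ (u₀ + t • v, z v t) v) h
          + Ψ (u₀ + t • v, z v t) h)) (Ψ (u₀ + t • (v + h), y t) (v + h)) ≤
        (C * M ^ 2 * δ + K * M) * ‖h‖ ^ 2 := by
      intro t ht
      set q := (u₀ + t • v, z v t) with hqdef
      set k : E × F := (t • h, t • Ψ q h) with hk
      have hq' : (u₀ + t • (v + h), y t) = q + k := by
        simp [hqdef, hk, hy, smul_add, add_assoc]
      have hqk := hC q (hq t ht) (q + k) (hq' ▸ hmem _ hvh t ht _ (hyb t ht))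
      rw [add_sub_cancel_left] at hqk
      have hkn : ‖k‖ ≤ M * ‖h‖ := by
        rw [Prod.norm_def]
        refine max_le ?_ (htAh t ht)
        rw [hk, norm_smul, Real.norm_of_nonneg ht.1]
        nlinarith [norm_nonneg h, ht.1, ht.2]
      have hkt : k = t • (h, Ψ q h) := rfl
      have hkv : fderiv ℝ Ψ q k v = t • fderiv ℝ Ψ q (v, Ψ q v) h := by
        rw [hkt, map_smul, _root_.smul_apply, hint q (hq t ht) v h]
      have heq : Ψ q v + (t • fderiv ℝ Ψ q (v, Ψ q v) h + Ψ q h) - Ψ (q + k) (v + h) =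
          -((Ψ (q + k) - Ψ q - fderiv ℝ Ψ q k) (v + h)) - fderiv ℝ Ψ q k h := by
        rw [← hkv]
        simp only [_root_.sub_apply, map_add]
        abel
      rw [hq', dist_eq_norm, heq]
      calc _ ≤ ‖(Ψ (q + k) - Ψ q - fderiv ℝ Ψ q k) (v + h)‖ + ‖fderiv ℝ Ψ q k h‖ := by
            rw [← norm_neg ((Ψ (q + k) - Ψ q - fderiv ℝ Ψ q k) (v + h))]
            exact norm_sub_le _ _
        _ ≤ (C * (M * ‖h‖) ^ 2) * δ + K * (M * ‖h‖) * ‖h‖ := by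
            refine add_le_add ((ContinuousLinearMap.le_opNorm _ _).trans ?_)
              (((fderiv ℝ Ψ q k).le_opNorm h).trans ?_)
            · exact mul_le_mul (hqk.trans (by gcongr)) hvh.le (norm_nonneg _) (by positivity)
            · have := ((fderiv ℝ Ψ q).le_opNorm k).trans
                (mul_le_mul (hK q (hq t ht)) hkn (norm_nonneg _) K.coe_nonneg)
              gcongr
        _ = _ := by ring
    have hmono : ∀ {f : ℝ → F} {f' : F} {t : ℝ}, t ∈ Ico (0 : ℝ) 1 →
        HasDerivWithinAt f f' (Icc 0 1) t → HasDerivWithinAt f f' (Ici t) t :=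
      fun ht hf => hf.mono_of_mem_nhdsWithin (Icc_mem_nhdsGE_of_mem ht)
    have hG := dist_le_of_approx_trajectories_ODE_of_mem
      (v := fun t x => Ψ (u₀ + t • (v + h), x) (v + h)) (s := fun _ => closedBall ν₀ (ρ : ℝ))
      (K := 1) (f := z (v + h)) (g := y) (a := 0) (b := 1) (εf := 0) (δ := 0)
      (fun t ht => hlip _ hvh t (Ico_subset_Icc_self ht))
      (fun t ht => (hwd t ht).continuousWithinAt)
      (fun t ht => hmono ht (hwd t (Ico_subset_Icc_self ht)))
      (fun t ht => (dist_self _).le) (fun t ht => hsub (hwb t))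
      (fun t ht => (hyd t ht).continuousWithinAt)
      (fun t ht => hmono ht (hyd t (Ico_subset_Icc_self ht)))
      (fun t ht => hyerr t (Ico_subset_Icc_self ht))
      (fun t ht => hyb t (Ico_subset_Icc_self ht)) (by simp [hy, hz0, hw0]) 1 (by simp)
    rw [dist_eq_norm, NNReal.coe_one, gronwallBound_of_K_ne_0 one_ne_zero] at hG
    simp only [hy, one_smul] at hG
    rw [sub_sub]
    refine hG.trans (le_of_eq ?_)
    simp
    ring
  refine ⟨fun u => z (u - u₀) 1, ?_, ?_⟩
  · obtain ⟨h0, -, hderiv⟩ := hz 0 (by simpa using hδ)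
    have := constant_of_has_deriv_right_zero (fun t ht => (hderiv t ht).continuousWithinAt)
      (fun t ht => by
        simpa using (hderiv t (Ico_subset_Icc_self ht)).mono_of_mem_nhdsWithin
          (Icc_mem_nhdsGE_of_mem ht)) 1 (by simp)
    simpa [h0] using this
  · filter_upwards [ball_mem_nhds u₀ (NNReal.coe_pos.2 hδ)] with u hu
    have hu' : ‖u - u₀‖ < δ := by simpa [dist_eq_norm] using hu
    rw [hasFDerivAt_iff_isLittleO_nhds_zero]
    refine Asymptotics.IsBigO.trans_isLittleO (g := fun h : E => ‖h‖ ^ 2) ?_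
      (Asymptotics.isLittleO_norm_pow_id one_lt_two)
    refine Asymptotics.IsBigO.of_bound ((C * M ^ 2 * δ + K * M) * (Real.exp 1 - 1)) ?_
    have hev : ∀ᶠ h in 𝓝 (0 : E), ‖u - u₀ + h‖ < δ := by
      have : ContinuousAt (fun h : E => ‖u - u₀ + h‖) 0 := by fun_prop
      exact this.eventually_lt_const (by simpa using hu')
    filter_upwards [hev] with h hh
    have := hest (u - u₀) h hu' hh
    rw [add_sub_cancel, show u - u₀ + h = u + h - u₀ by abel] at this
    simpa using this

/-- Solutions of the total differential equation `Dν = Ψ (u, ν)` with smooth `Ψ` are smooth. -/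
theorem contDiffOn_of_hasFDerivAt_eq
    {E F : Type*} [NormedAddCommGroup E] [NormedSpace ℝ E] [NormedAddCommGroup F] [NormedSpace ℝ F]
    {Ψ : E × F → E →L[ℝ] F} {D : Set (E × F)} {W : Set E} {ν : E → F}
    (hΨ : ContDiffOn ℝ (⊤ : ℕ∞) Ψ D) (hW : IsOpen W) (hWD : ∀ u ∈ W, (u, ν u) ∈ D)
    (hν : ∀ u ∈ W, HasFDerivAt ν (Ψ (u, ν u)) u) : ContDiffOn ℝ (⊤ : ℕ∞) ν W := by
  refine contDiffOn_infty.2 fun n => ?_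
  induction n with
  | zero => exact contDiffOn_zero.2 fun u hu => (hν u hu).continuousAt.continuousWithinAt
  | succ n ih =>
    push_cast
    rw [contDiffOn_succ_iff_hasFDerivWithinAt_of_uniqueDiffOn hW.uniqueDiffOn]
    exact ⟨by simp, _, (hΨ.of_le (by exact_mod_cast le_top)).comp (contDiffOn_id.prodMk ih) hWD,
      fun u hu => (hν u hu).hasFDerivWithinAt⟩


/-- **Theorem 8.1, sufficiency.**  If a complete system of Pfaff equations
`∂ν/∂uᵏ = ψₖ(u, ν)` with smooth right hand sides satisfies the compatibility conditions
`∂ψₖ/∂uʳ + (∂ψₖ/∂ν)·ψᵣ = ∂ψᵣ/∂uᵏ + (∂ψᵣ/∂ν)·ψₖ` on an open set `D ⊆ ℝᵐ × ℝ`, then through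
every point `(u₀, ν₀) ∈ D` there passes a local smooth solution normalized by `ν(u₀) = ν₀`. -/
theorem pfaff_sufficiency {m : ℕ} (hm : 1 ≤ m)
    (D : Set ((Fin m → ℝ) × ℝ)) (hD : IsOpen D)
    (ψ : (Fin m → ℝ) × ℝ → Fin m → ℝ)
    (hψ : ContDiffOn ℝ (⊤ : ℕ∞) ψ D)
    (hcompat : ∀ p ∈ D, ∀ k r : Fin m,
      fderiv ℝ (fun q => ψ q k) p ((Pi.single r 1 : Fin m → ℝ), (0 : ℝ)) +
        fderiv ℝ (fun q => ψ q k) p ((0 : Fin m → ℝ), (1 : ℝ)) * ψ p r =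
      fderiv ℝ (fun q => ψ q r) p ((Pi.single k 1 : Fin m → ℝ), (0 : ℝ)) +
        fderiv ℝ (fun q => ψ q r) p ((0 : Fin m → ℝ), (1 : ℝ)) * ψ p k) :
    ∀ p₀ ∈ D, ∃ W : Set (Fin m → ℝ), IsOpen W ∧ p₀.1 ∈ W ∧
      ∃ ν : (Fin m → ℝ) → ℝ, ContDiffOn ℝ (⊤ : ℕ∞) ν W ∧ ν p₀.1 = p₀.2 ∧
        (∀ u ∈ W, (u, ν u) ∈ D) ∧
        (∀ u ∈ W, ∀ k : Fin m, fderiv ℝ ν u (Pi.single k 1) = ψ (u, ν u) k) := by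
  intro p₀ hp₀
  set Ψ : (Fin m → ℝ) × ℝ → (Fin m → ℝ) →L[ℝ] ℝ :=
    fun q => ∑ k, ψ q k • ContinuousLinearMap.proj k with hΨdef
  have hψk : ∀ k, ContDiffOn ℝ (⊤ : ℕ∞) (fun q => ψ q k) D := contDiffOn_pi.1 hψ
  have hΨ : ContDiffOn ℝ (⊤ : ℕ∞) Ψ D :=
    ContDiffOn.sum fun k _ => (hψk k).smul contDiffOn_const
  have hΨ_apply : ∀ q v, Ψ q v = ∑ k, ψ q k * v k := by
    intro q v
    simp [hΨdef]
  have hΨ' : ∀ p ∈ D, ∀ w h,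
      fderiv ℝ Ψ p w h = ∑ k, fderiv ℝ (fun q => ψ q k) p w * h k := by
    intro p hp w h
    have hd : ∀ k, DifferentiableAt ℝ (fun q => ψ q k) p := fun k =>
      ((hψk k).contDiffAt (hD.mem_nhds hp)).differentiableAt (by simp)
    have : HasFDerivAt Ψ (∑ k, (fderiv ℝ (fun q => ψ q k) p).smulRight
        (ContinuousLinearMap.proj k : (Fin m → ℝ) →L[ℝ] ℝ)) p :=
      HasFDerivAt.fun_sum fun k _ => (hd k).hasFDerivAt.smul_const
        (ContinuousLinearMap.proj k : (Fin m → ℝ) →L[ℝ] ℝ)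
    rw [this.fderiv]
    simp
  have hexp : ∀ (L : (Fin m → ℝ) × ℝ →L[ℝ] ℝ) (p : (Fin m → ℝ) × ℝ) (v : Fin m → ℝ),
      L (v, Ψ p v) = ∑ r, (L (Pi.single r 1, 0) + L (0, 1) * ψ p r) * v r := by
    intro L p v
    have hv : ((v, Ψ p v) : (Fin m → ℝ) × ℝ) =
        ∑ r, v r • ((Pi.single r 1, 0) + ψ p r • (0, 1) : (Fin m → ℝ) × ℝ) := by
      refine Prod.ext ?_ ?_
      · ext i
        simp [Prod.fst_sum, Finset.sum_apply, Pi.single_apply]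
      · simp [Prod.snd_sum, hΨ_apply, mul_comm]
    rw [hv, map_sum]
    refine Finset.sum_congr rfl fun r _ => ?_
    rw [map_smul, map_add, map_smul, smul_eq_mul, smul_eq_mul]
    ring
  have hint : ∀ p ∈ D, ∀ v h,
      fderiv ℝ Ψ p (v, Ψ p v) h = fderiv ℝ Ψ p (h, Ψ p h) v := by
    intro p hp v h
    simp only [hΨ' p hp, hexp, Finset.sum_mul]
    rw [Finset.sum_comm]
    refine Finset.sum_congr rfl fun r _ => Finset.sum_congr rfl fun k _ => ?_
    rw [hcompat p hp k r]
    ring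
  obtain ⟨ν, hν₀, hν⟩ := exists_eventually_hasFDerivAt_of_integrable
    ((contDiffOn_infty.1 hΨ 2).contDiffAt (hD.mem_nhds hp₀))
    (eventually_of_mem (hD.mem_nhds hp₀) hint)
  have hνD : ∀ᶠ u in 𝓝 p₀.1, (u, ν u) ∈ D :=
    (continuousAt_id.prodMk hν.self_of_nhds.continuousAt).eventually
      (hD.mem_nhds (by simpa [hν₀] using hp₀))
  obtain ⟨W, hW, hWo, hpW⟩ := _root_.eventually_nhds_iff.1 (hν.and hνD)
  refine ⟨W, hWo, hpW, ν, contDiffOn_of_hasFDerivAt_eq hΨ hWo (fun u hu => (hW u hu).2)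
    (fun u hu => (hW u hu).1), hν₀, fun u hu => (hW u hu).2, fun u hu k => ?_⟩
  rw [(hW u hu).1.fderiv, hΨ_apply]
  simp [Pi.single_apply]
end

section
/- (Lemma 10.1, with the remark on prescribed frames.) Let U be an open subset of ℝⁿ and g : U → Matrix (Fin n) (Fin n) ℝ a C^∞ map such that g(x) is symmetric and positive definite for every x ∈ U, and let p₀ ∈ U and T be an invertible n×n real matrix. Then there exist an open neighborhood V of 0 in ℝⁿ and a C^∞ map φ : V → ℝⁿ such that: φ(V) ⊆ U, φ(0) = p₀, the derivative Dφ(0) equals T, φ is a diffeomorphism of V onto an open neighborhood of p₀ in U, and the Christoffel symbols of the pullback metric h, defined by h_{ij}(y) = Σ_{a,b} g_{ab}(φ(y)) ∂ᵢφᵃ(y) ∂ⱼφᵇ(y), all vanish at y = 0. -/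
theorem exists_isOpen_local_diffeomorphism {E F : Type*}
    [NormedAddCommGroup E] [NormedSpace ℝ E] [CompleteSpace E]
    [NormedAddCommGroup F] [NormedSpace ℝ F] [CompleteSpace F]
    {φ : E → F} (hφ : ContDiff ℝ (⊤ : ℕ∞) φ) {x : E} (L : E ≃L[ℝ] F)
    (hL : fderiv ℝ φ x = L) {U : Set F} (hU : IsOpen U) (hxU : φ x ∈ U) :
    ∃ V : Set E, IsOpen V ∧ x ∈ V ∧ φ '' V ⊆ U ∧ IsOpen (φ '' V) ∧ Set.InjOn φ V ∧
      ∃ ψ : F → E, ContDiffOn ℝ (⊤ : ℕ∞) ψ (φ '' V) ∧ ∀ y ∈ V, ψ (φ y) = y := by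
  have hd : HasFDerivAt φ (L : E →L[ℝ] F) x :=
    hL ▸ (hφ.differentiable (by simp) x).hasFDerivAt
  set e := hφ.contDiffAt.toOpenPartialHomeomorph φ hd (by simp)
  have hcoe : (e : E → F) = φ := rfl
  have hxe : x ∈ e.source := hφ.contDiffAt.mem_toOpenPartialHomeomorph_source hd (by simp)
  let W : Set E := φ ⁻¹' U ∩ fderiv ℝ φ ⁻¹' Set.range ((↑) : (E ≃L[ℝ] F) → E →L[ℝ] F)
  have hW : IsOpen W := (hU.preimage hφ.continuous).inter
    ((ContinuousLinearEquiv.isOpen (𝕜 := ℝ)).preimage (hφ.continuous_fderiv (by simp)))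
  refine ⟨e.source ∩ W, e.open_source.inter hW, ⟨hxe, hxU, L, hL.symm⟩, ?_, ?_,
    e.injOn.mono Set.inter_subset_left, e.symm, ?_, fun y hy => e.left_inv hy.1⟩
  · rintro _ ⟨y, hy, rfl⟩
    exact hy.2.1
  · exact e.isOpen_image_of_subset_source (e.open_source.inter hW) Set.inter_subset_left
  · rintro _ ⟨y, ⟨hye, -, M, hM⟩, rfl⟩
    have hy : e.symm (φ y) = y := e.left_inv hye
    refine (e.contDiffAt_symm (f₀' := M) (e.map_source hye) ?_ ?_).contDiffWithinAt
    · rw [hcoe, hy, hM]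
      exact (hφ.differentiable (by simp) y).hasFDerivAt
    · exact hφ.contDiffAt

/-- The quadratic polynomial map with value `p`, linear part `T` and Hessian `S` at the origin. -/
noncomputable def quadraticMap {n : ℕ} (p : Fin n → ℝ) (T : Matrix (Fin n) (Fin n) ℝ)
    (S : Fin n → Fin n → Fin n → ℝ) (y : Fin n → ℝ) : Fin n → ℝ :=
  fun a => p a + ∑ i, T a i * y i + (1 / 2) * ∑ m, ∑ i, S a m i * y m * y i

theorem contDiff_quadraticMap {n : ℕ} (p : Fin n → ℝ) (T : Matrix (Fin n) (Fin n) ℝ)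
    (S : Fin n → Fin n → Fin n → ℝ) : ContDiff ℝ (⊤ : ℕ∞) (quadraticMap p T S) := by
  unfold quadraticMap
  fun_prop

theorem fderiv_quadraticMap_component {n : ℕ} (p : Fin n → ℝ) (T : Matrix (Fin n) (Fin n) ℝ)
    {S : Fin n → Fin n → Fin n → ℝ} (hS : ∀ a m i, S a m i = S a i m) (a : Fin n)
    (y w : Fin n → ℝ) :
    fderiv ℝ (fun z => quadraticMap p T S z a) y w =
      ∑ i, (T a i + ∑ m, S a m i * y m) * w i := by
  have hc : ∀ i, HasFDerivAt (fun z : Fin n → ℝ => z i)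
      (ContinuousLinearMap.proj (R := ℝ) (φ := fun _ : Fin n => ℝ) i) y :=
    fun i => hasFDerivAt_apply i y
  have h := ((HasFDerivAt.fun_sum (u := Finset.univ) fun i _ =>
    (hc i).const_mul (T a i)).const_add (p a)).add
      ((HasFDerivAt.fun_sum (u := Finset.univ) fun m _ =>
        HasFDerivAt.fun_sum (u := Finset.univ) fun i _ =>
          ((hc m).const_mul (S a m i)).mul (hc i)).const_mul (1 / 2))
  have h' : HasFDerivAt (fun z => quadraticMap p T S z a) _ y := h
  rw [h'.fderiv]
  simp only [add_apply, sum_apply, smul_apply, ContinuousLinearMap.proj_apply, smul_eq_mul, add_mul,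
    Finset.sum_add_distrib, add_right_inj]
  rw [Finset.sum_comm (f := fun m i => y i * (S a m i * w m))]
  have e : ∀ i m, y i * (S a m i * w m) = S a i m * y i * w m := fun i m => by
    rw [hS a m i]; ring
  simp only [e, Finset.sum_mul]
  rw [Finset.sum_comm (f := fun i m => S a m i * y m * w i)]
  ring

theorem fderiv_quadraticMap_component_single {n : ℕ} (p : Fin n → ℝ)
    (T : Matrix (Fin n) (Fin n) ℝ) {S : Fin n → Fin n → Fin n → ℝ}
    (hS : ∀ a m i, S a m i = S a i m) (a i : Fin n) (y : Fin n → ℝ) :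
    fderiv ℝ (fun z => quadraticMap p T S z a) y (Pi.single i 1) =
      T a i + ∑ m, S a m i * y m := by
  simp [fderiv_quadraticMap_component p T hS, Pi.single_apply]

theorem fderiv_quadraticMap_zero {n : ℕ} (p : Fin n → ℝ) (T : Matrix (Fin n) (Fin n) ℝ)
    {S : Fin n → Fin n → Fin n → ℝ} (hS : ∀ a m i, S a m i = S a i m) (w : Fin n → ℝ) :
    fderiv ℝ (quadraticMap p T S) 0 w = T.mulVec w := by
  have hd : DifferentiableAt ℝ (quadraticMap p T S) 0 :=
    (contDiff_quadraticMap p T S).differentiable (by simp) 0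
  funext a
  have h := fderiv_quadraticMap_component p T hS a 0 w
  rw [fderiv_apply hd] at h
  simpa [Matrix.mulVec, dotProduct] using h

theorem quadraticMap_zero {n : ℕ} (p : Fin n → ℝ) (T : Matrix (Fin n) (Fin n) ℝ)
    (S : Fin n → Fin n → Fin n → ℝ) : quadraticMap p T S 0 = p := by
  funext a
  simp [quadraticMap]

theorem fderiv_pullback_quadraticMap {n : ℕ} {g : (Fin n → ℝ) → Matrix (Fin n) (Fin n) ℝ}
    {p : Fin n → ℝ} (hg : ∀ a c, DifferentiableAt ℝ (fun x => g x a c) p)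
    (T : Matrix (Fin n) (Fin n) ℝ) {S : Fin n → Fin n → Fin n → ℝ}
    (hS : ∀ a m i, S a m i = S a i m) (m i j : Fin n) :
    fderiv ℝ (fun y => ∑ a, ∑ c, g (quadraticMap p T S y) a c *
        fderiv ℝ (fun z => quadraticMap p T S z a) y (Pi.single i 1) *
        fderiv ℝ (fun z => quadraticMap p T S z c) y (Pi.single j 1)) 0 (Pi.single m 1) =
      (∑ a, ∑ c, fderiv ℝ (fun x => g x a c) p (T.mulVec (Pi.single m 1)) * T a i * T c j) +
        ∑ a, ∑ c, g p a c * (S a m i * T c j + T a i * S c m j) := by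
  simp only [fderiv_quadraticMap_component_single p T hS]
  have hφ : HasFDerivAt (quadraticMap p T S) (fderiv ℝ (quadraticMap p T S) 0) 0 :=
    ((contDiff_quadraticMap p T S).differentiable (by simp) 0).hasFDerivAt
  have hgφ : ∀ a c, HasFDerivAt (fun y => g (quadraticMap p T S y) a c)
      ((fderiv ℝ (fun x => g x a c) p).comp (fderiv ℝ (quadraticMap p T S) 0)) 0 :=
    fun a c => HasFDerivAt.comp (g := fun x => g x a c) 0
      (by rw [quadraticMap_zero]; exact (hg a c).hasFDerivAt) hφ
  have hJ : ∀ a i, HasFDerivAt (fun y : Fin n → ℝ => T a i + ∑ m, S a m i * y m)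
      (∑ m, S a m i • ContinuousLinearMap.proj (R := ℝ) (φ := fun _ : Fin n => ℝ) m) 0 :=
    fun a i => (HasFDerivAt.fun_sum (u := Finset.univ) fun m _ =>
      (hasFDerivAt_apply m (0 : Fin n → ℝ)).const_mul (S a m i)).const_add (T a i)
  have h := HasFDerivAt.fun_sum (u := Finset.univ) fun a _ =>
    HasFDerivAt.fun_sum (u := Finset.univ) fun c _ => ((hgφ a c).fun_mul (hJ a i)).fun_mul (hJ c j)
  rw [HasFDerivAt.fderiv h]
  simp only [add_apply, sum_apply, smul_apply, ContinuousLinearMap.comp_apply,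
    ContinuousLinearMap.proj_apply, smul_eq_mul, quadraticMap_zero,
    fderiv_quadraticMap_zero p T hS, Pi.zero_apply, mul_zero, Finset.sum_const_zero, add_zero,
    Pi.single_apply, mul_ite, mul_one, Finset.sum_ite_eq', Finset.mem_univ,
    if_true, ← Finset.sum_add_distrib]
  exact Finset.sum_congr rfl fun a _ => Finset.sum_congr rfl fun c _ => by ring

/-- At an invertible frame, the Hessian of a map can be prescribed so as to cancel
the first derivatives `H` of the metric. -/
theorem exists_symm_hessian {n : ℕ} {G T : Matrix (Fin n) (Fin n) ℝ} (hG : G.IsSymm)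
    (hGT : IsUnit (G * T).det) {H : Fin n → Fin n → Fin n → ℝ}
    (hH : ∀ m i j, H m i j = H m j i) :
    ∃ S : Fin n → Fin n → Fin n → ℝ, (∀ a m i, S a m i = S a i m) ∧
      ∀ m i j, H m i j + ∑ a, ∑ c, G a c * (S a m i * T c j + T a i * S c m j) = 0 := by
  let K : Fin n → Fin n → Fin n → ℝ := fun m i j => -(1 / 2) * (H m i j + H i m j - H j m i)
  have hK : ∀ m i, K m i = K i m := fun m i => by
    funext j
    simp only [K, hH j m i]
    ring
  refine ⟨fun a m i => Matrix.vecMul (K m i) (G * T)⁻¹ a, fun a m i => by simp only [hK m i], ?_⟩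
  intro m i j
  have key : ∀ m i j, ∑ a, ∑ c, G a c * (Matrix.vecMul (K m i) (G * T)⁻¹ a * T c j) = K m i j := by
    intro m i j
    have h : Matrix.vecMul (Matrix.vecMul (K m i) (G * T)⁻¹) (G * T) = K m i := by
      rw [Matrix.vecMul_vecMul, Matrix.nonsing_inv_mul _ hGT, Matrix.vecMul_one]
    rw [← congrFun h j]
    conv_rhs => rw [Matrix.vecMul, dotProduct]
    refine Finset.sum_congr rfl fun a _ => ?_
    rw [Matrix.mul_apply, Finset.mul_sum]
    exact Finset.sum_congr rfl fun c _ => by ring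
  have key' : ∑ a, ∑ c, G a c * (T a i * Matrix.vecMul (K m j) (G * T)⁻¹ c) = K m j i := by
    rw [← key m j i, Finset.sum_comm]
    exact Finset.sum_congr rfl fun a _ => Finset.sum_congr rfl fun c _ => by
      rw [hG.apply]; ring
  simp only [mul_add, Finset.sum_add_distrib, key, key']
  simp only [K]
  linear_combination (1 / 2) * hH m i j

/-- **Lemma 10.1 (with remark on prescribed frames).**  For any point `p₀` of a Riemannian
metric `g` on an open `U ⊆ ℝⁿ` and any invertible matrix `T` there is a local smooth
diffeomorphism `φ` of a neighborhood `V` of `0` onto an open neighborhood of `p₀` in `U` with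
`φ(0) = p₀` and `Dφ(0) = T`, such that all Christoffel symbols of the pulled-back metric
`h_{ij}(y) = Σ_{a,b} g_{ab}(φ(y)) ∂ᵢφᵃ(y) ∂ⱼφᵇ(y)` vanish at `y = 0`. -/
theorem exists_normal_coordinates {n : ℕ}
    (U : Set (Fin n → ℝ)) (hU : IsOpen U)
    (g : (Fin n → ℝ) → Matrix (Fin n) (Fin n) ℝ)
    (hsmooth : ∀ i j : Fin n, ContDiffOn ℝ (⊤ : ℕ∞) (fun x => g x i j) U)
    (hsym : ∀ x ∈ U, (g x).IsSymm)
    (hpos : ∀ x ∈ U, (g x).PosDef)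
    (p₀ : Fin n → ℝ) (hp₀ : p₀ ∈ U)
    (T : Matrix (Fin n) (Fin n) ℝ) (hT : IsUnit T.det) :
    ∃ V : Set (Fin n → ℝ), IsOpen V ∧ (0 : Fin n → ℝ) ∈ V ∧
      ∃ φ : (Fin n → ℝ) → (Fin n → ℝ),
        ContDiffOn ℝ (⊤ : ℕ∞) φ V ∧
        φ '' V ⊆ U ∧
        φ 0 = p₀ ∧
        (∀ w : Fin n → ℝ, fderiv ℝ φ 0 w = T.mulVec w) ∧
        IsOpen (φ '' V) ∧ Set.InjOn φ V ∧
        (∃ ψ : (Fin n → ℝ) → (Fin n → ℝ),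
          ContDiffOn ℝ (⊤ : ℕ∞) ψ (φ '' V) ∧ ∀ y ∈ V, ψ (φ y) = y) ∧
        (∀ k i j : Fin n,
          christoffel
            (fun y => Matrix.of fun i' j' : Fin n =>
              ∑ a : Fin n, ∑ c : Fin n, g (φ y) a c *
                fderiv ℝ (fun z => φ z a) y (Pi.single i' 1) *
                fderiv ℝ (fun z => φ z c) y (Pi.single j' 1))
            0 k i j = 0) := by
  have hg : ∀ a c, DifferentiableAt ℝ (fun x => g x a c) p₀ := fun a c =>
    ((hsmooth a c).contDiffAt (hU.mem_nhds hp₀)).differentiableAt (by simp)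
  have hGT : IsUnit (g p₀ * T).det := by
    rw [Matrix.det_mul]
    exact (hpos p₀ hp₀).det_pos.ne'.isUnit.mul hT
  obtain ⟨S, hS, hSH⟩ := exists_symm_hessian (hsym p₀ hp₀) hGT
    (H := fun m i j => ∑ a, ∑ c,
      fderiv ℝ (fun x => g x a c) p₀ (T.mulVec (Pi.single m 1)) * T a i * T c j) (by
      intro m i j
      have hfd : ∀ a c, fderiv ℝ (fun x => g x a c) p₀ = fderiv ℝ (fun x => g x c a) p₀ := by
        intro a c
        refine Filter.EventuallyEq.fderiv_eq ?_
        filter_upwards [hU.mem_nhds hp₀] with x hx using (hsym x hx).apply c a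
      rw [Finset.sum_comm]
      refine Finset.sum_congr rfl fun a _ => Finset.sum_congr rfl fun c _ => ?_
      rw [hfd]
      ring)
  let L : (Fin n → ℝ) ≃L[ℝ] (Fin n → ℝ) :=
    (Matrix.toLinearEquiv' T (T.invertibleOfIsUnitDet hT)).toContinuousLinearEquiv
  have hL : fderiv ℝ (quadraticMap p₀ T S) 0 = (L : (Fin n → ℝ) →L[ℝ] (Fin n → ℝ)) :=
    ContinuousLinearMap.ext fun w => fderiv_quadraticMap_zero p₀ T hS w
  have hφ := contDiff_quadraticMap p₀ T S
  have hφ0 := quadraticMap_zero p₀ T S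
  obtain ⟨V, hV, h0, hVU, hopen, hinj, hψ⟩ :=
    exists_isOpen_local_diffeomorphism hφ L hL hU (by rwa [hφ0])
  refine ⟨V, hV, h0, quadraticMap p₀ T S, hφ.contDiffOn, hVU, hφ0,
    fderiv_quadraticMap_zero p₀ T hS, hopen, hinj, hψ, fun k i j => ?_⟩
  have hd := fun m i j => (fderiv_pullback_quadraticMap hg T hS m i j).trans (hSH m i j)
  simp only [christoffel, Matrix.of_apply]
  refine mul_eq_zero_of_right _ (Finset.sum_eq_zero fun s _ => mul_eq_zero_of_right _ ?_)
  rw [hd, hd, hd, add_zero, sub_zero]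
end

section
/- (Theorem 9.4 on the second fundamental form, local coordinate form.) Let n ≥ 3, let U be an open subset of ℝⁿ and g : U → Matrix (Fin n) (Fin n) ℝ a C^∞ map such that g(x) is symmetric and positive definite for every x ∈ U, with Christoffel symbols Γᵏᵢⱼ. Let p₀ ∈ U, let v₀ ∈ ℝⁿ be nonzero, let α be the g(p₀)-orthogonal hyperplane to v₀, and let P : ℝⁿ → ℝⁿ be the g(p₀)-orthogonal projection onto α. Let H : ℝⁿ → ℝⁿ be a linear operator that is symmetric with respect to the inner product ⟨x,y⟩ = Σ g_{ij}(p₀) xⁱ yʲ and satisfies H ∘ P = P ∘ H = H. Then there exist an open neighborhood W of 0 in ℝⁿ⁻¹ and a C^∞ immersion r : W → U with r(0) = p₀ whose coordinate tangent vectors τ_a = ∂r/∂uᵃ(0) form a basis of α, such that H is determined by the second fundamental form of the hypersurface r according to H y = Σ_{m,a,k} ⟨τ_a, y⟩ ρᵃᵏ bᵐ_k τ_m for all y ∈ ℝⁿ, where ρ_{ak} = ⟨τ_a, τ_k⟩ is the induced Gram matrix, ρᵃᵏ are the entries of ρ⁻¹, b_{kr} = ⟨n₀, ∂²r/∂uᵏ∂uʳ(0)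 + Γ(p₀)(τ_k, τ_r)⟩ is the second fundamental form of r at p₀ with respect to the g(p₀)-unit normal n₀ = v₀/|v₀|_{g(p₀)}, and bᵐ_k = Σ_r b_{kr} ρʳᵐ. -/
/-- The inner product on `ℝⁿ` defined by a matrix `A`: `⟨x, y⟩_A = Σ_{i,j} A_{ij} xⁱ yʲ`. -/
def gInner {n : ℕ} (A : Matrix (Fin n) (Fin n) ℝ) (x y : Fin n → ℝ) : ℝ :=
  ∑ i : Fin n, ∑ j : Fin n, A i j * x i * y j

/-- `gInner A` is the bilinear form attached to the matrix `A`. -/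
theorem gInner_eq_toBilin' {n : ℕ} (A : Matrix (Fin n) (Fin n) ℝ) (x y : Fin n → ℝ) :
    gInner A x y = Matrix.toBilin' A x y := by
  rw [Matrix.toBilin'_apply, gInner]
  exact Finset.sum_congr rfl fun i _ => Finset.sum_congr rfl fun j _ => by ring

/-- The Christoffel symbols of a metric that is symmetric near `x` are symmetric in the lower
indices. -/
theorem christoffel_comm {n : ℕ} {g : (Fin n → ℝ) → Matrix (Fin n) (Fin n) ℝ} {x : Fin n → ℝ}
    (hg : ∀ᶠ y in nhds x, (g y).IsSymm) (k i j : Fin n) :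
    christoffel g x k i j = christoffel g x k j i := by
  have h : ∀ a b, fderiv ℝ (fun y => g y a b) x = fderiv ℝ (fun y => g y b a) x := fun a b =>
    Filter.EventuallyEq.fderiv_eq (hg.mono fun y hy => hy.apply b a)
  unfold christoffel
  congr 1
  refine Finset.sum_congr rfl fun s _ => ?_
  rw [h s j, h i s, h i j]
  ring

section Gram

variable {E ι : Type*} [AddCommGroup E] [Module ℝ E] [Fintype ι] [DecidableEq ι]

/-- The Gram matrix of a linearly independent family for a positive definite form is invertible. -/
theorem isUnit_gram {B : E →ₗ[ℝ] E →ₗ[ℝ] ℝ} (hB : ∀ x, x ≠ 0 → 0 < B x x) {τ : ι → E}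
    (hτ : LinearIndependent ℝ τ) : IsUnit (Matrix.of fun a k => B (τ a) (τ k)) := by
  rw [← Matrix.mulVec_injective_iff_isUnit]
  refine (injective_iff_map_eq_zero (Matrix.mulVecLin _)).2 fun c hc => ?_
  have hrow : ∀ a, B (τ a) (∑ k, c k • τ k) = 0 := fun a => by
    have := congrFun hc a
    simpa [Matrix.mulVec, dotProduct, mul_comm] using this
  have hx : ∑ k, c k • τ k = 0 := by
    by_contra hne
    have hzero : B (∑ k, c k • τ k) (∑ k, c k • τ k) = 0 := by
      rw [LinearMap.map_sum₂]
      simp only [LinearMap.map_smul₂, hrow, smul_zero, Finset.sum_const_zero]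
    exact (hB _ hne).ne' hzero
  exact funext (Fintype.linearIndependent_iff.1 hτ c hx)

/-- Coordinates of a vector in the span of a family, in terms of the inverse Gram matrix. -/
theorem eq_sum_gram_inv_smul {B : E →ₗ[ℝ] E →ₗ[ℝ] ℝ} (hsymm : ∀ x y, B x y = B y x)
    (hB : ∀ x, x ≠ 0 → 0 < B x x) {τ : ι → E} (hτ : LinearIndependent ℝ τ) {x : E}
    (hx : x ∈ Submodule.span ℝ (Set.range τ)) :
    x = ∑ m, (∑ q, B (τ q) x * (Matrix.of fun a k => B (τ a) (τ k))⁻¹ q m) • τ m := by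
  obtain ⟨c, rfl⟩ := (Submodule.mem_span_range_iff_exists_fun ℝ).1 hx
  refine Finset.sum_congr rfl fun m _ => ?_
  congr 1
  have hrow : (fun q => B (τ q) (∑ k, c k • τ k)) =
      Matrix.vecMul c (Matrix.of fun a k => B (τ a) (τ k)) := by
    ext q
    simp [Matrix.vecMul, dotProduct, hsymm (τ q)]
  have hdet := (Matrix.isUnit_iff_isUnit_det _).1 (isUnit_gram hB hτ)
  change c m = Matrix.vecMul (fun q => B (τ q) (∑ k, c k • τ k)) _ m
  rw [hrow, Matrix.vecMul_vecMul, Matrix.mul_nonsing_inv _ hdet, Matrix.vecMul_one]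

/-- A symmetric operator with values in the span of `τ` is determined by its matrix entries on
`τ`. -/
theorem symmetric_apply_eq_sum_gram_inv {B : E →ₗ[ℝ] E →ₗ[ℝ] ℝ}
    (hsymm : ∀ x y, B x y = B y x) (hB : ∀ x, x ≠ 0 → 0 < B x x) {τ : ι → E}
    (hτ : LinearIndependent ℝ τ) {H : E →ₗ[ℝ] E} (hH : ∀ x y, B x (H y) = B (H x) y)
    (hrange : ∀ y, H y ∈ Submodule.span ℝ (Set.range τ)) (y : E) :
    H y = ∑ m, ∑ a, ∑ k, (B (τ a) y * (Matrix.of fun a k => B (τ a) (τ k))⁻¹ a k *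
      ∑ q, B (τ k) (H (τ q)) * (Matrix.of fun a k => B (τ a) (τ k))⁻¹ q m) • τ m := by
  set ρ : Matrix ι ι ℝ := Matrix.of fun a k => B (τ a) (τ k) with hρ
  have hρinv : ∀ a k, ρ⁻¹ k a = ρ⁻¹ a k := fun a k => by
    have hρsymm : ρ.IsSymm := Matrix.IsSymm.ext fun i j => hsymm _ _
    have := Matrix.transpose_nonsing_inv ρ
    rw [hρsymm.eq] at this
    exact congrFun (congrFun this a) k
  have hcoeff : ∀ q, B (τ q) (H y) =
      ∑ a, ∑ k, B (τ a) y * ρ⁻¹ a k * B (τ k) (H (τ q)) := fun q => by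
    rw [hH]
    nth_rewrite 1 [eq_sum_gram_inv_smul hsymm hB hτ (hrange (τ q))]
    rw [map_sum, LinearMap.sum_apply]
    refine Finset.sum_congr rfl fun a _ => ?_
    rw [map_smul, LinearMap.smul_apply, smul_eq_mul, Finset.sum_mul]
    refine Finset.sum_congr rfl fun k _ => ?_
    rw [← hρ, hρinv]
    ring
  nth_rewrite 1 [eq_sum_gram_inv_smul hsymm hB hτ (hrange y)]
  refine Finset.sum_congr rfl fun m _ => ?_
  rw [← hρ]
  simp only [← Finset.sum_smul]
  congr 1
  simp only [hcoeff, Finset.sum_mul, Finset.mul_sum]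
  rw [Finset.sum_comm]
  refine Finset.sum_congr rfl fun a _ => ?_
  rw [Finset.sum_comm]
  exact Finset.sum_congr rfl fun k _ => Finset.sum_congr rfl fun q _ => by ring

end Gram

section Quadratic

variable {V F : Type*} [NormedAddCommGroup V] [NormedSpace ℝ V] [NormedAddCommGroup F]
  [NormedSpace ℝ F]

/-- The quadratic map with value `p`, differential `L` and second differential `Q` in the
direction `v` at the origin. -/
noncomputable def quadraticGraph (p : F) (L : V →L[ℝ] F) (Q : V →L[ℝ] V →L[ℝ] ℝ) (v : F)
    (u : V) : F :=
  p + L u + ((1 / 2 : ℝ) * Q u u) • v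

theorem quadraticGraph_zero (p : F) (L : V →L[ℝ] F) (Q : V →L[ℝ] V →L[ℝ] ℝ) (v : F) :
    quadraticGraph p L Q v 0 = p := by
  simp [quadraticGraph]

theorem contDiff_quadraticGraph (p : F) (L : V →L[ℝ] F) (Q : V →L[ℝ] V →L[ℝ] ℝ) (v : F)
    {k : WithTop ℕ∞} : ContDiff ℝ k (quadraticGraph p L Q v) := by
  unfold quadraticGraph
  fun_prop

theorem hasFDerivAt_quadraticGraph (p : F) (L : V →L[ℝ] F) {Q : V →L[ℝ] V →L[ℝ] ℝ}
    (hQ : ∀ x y, Q x y = Q y x) (v : F) (u : V) :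
    HasFDerivAt (quadraticGraph p L Q v) (L + (Q u).smulRight v) u := by
  have hQu : HasFDerivAt (fun u => (1 / 2 : ℝ) * Q u u) (Q u) u := by
    refine ((Q.hasFDerivAt.clm_apply (hasFDerivAt_id u)).const_mul (1 / 2 : ℝ)).congr_fderiv ?_
    ext w
    simp [hQ w u]
    ring
  exact (L.hasFDerivAt.const_add p).add (hQu.smul_const v)

end Quadratic

/-- The second partial derivatives of the components of `quadraticGraph`. -/
theorem fderiv_fderiv_quadraticGraph_apply {V κ : Type*} [NormedAddCommGroup V]
    [NormedSpace ℝ V] [Fintype κ] (p : κ → ℝ) (L : V →L[ℝ] κ → ℝ) {Q : V →L[ℝ] V →L[ℝ] ℝ}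
    (hQ : ∀ x y, Q x y = Q y x) (v : κ → ℝ) (c : κ) (x y u : V) :
    fderiv ℝ (fun u => fderiv ℝ (fun u' => quadraticGraph p L Q v u' c) u y) u x =
      Q x y * v c := by
  have h : (fun u => fderiv ℝ (fun u' => quadraticGraph p L Q v u' c) u y) =
      fun u => L y c + Q u y * v c := by
    ext u
    rw [(hasFDerivAt_pi'.1 (hasFDerivAt_quadraticGraph p L hQ v u) c).fderiv]
    simp
  have hd : HasFDerivAt (fun u => L y c + Q u y * v c) (v c • Q.flip y) u :=
    ((Q.flip y).hasFDerivAt.mul_const (v c)).const_add (L y c)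
  rw [h, hd.fderiv]
  simp [mul_comm]

/-- **Theorem 9.4 on the second fundamental form (local coordinate form).**  Let `P` be the
`g(p₀)`-orthogonal projection onto the `g(p₀)`-orthogonal hyperplane `α` to a nonzero vector
`v₀`, and let `H` be a linear operator, symmetric with respect to `⟨·,·⟩_{g(p₀)}`, with
`H ∘ P = P ∘ H = H`.  Then there is a smoothly immersed hypersurface `r` through `p₀` whose
coordinate tangent vectors `τ_a` at `p₀` form a basis of `α` and such that
`H y = Σ_{m,a,k} ⟨τ_a, y⟩ ρᵃᵏ bᵐ_k τ_m`, where `ρ` is the Gram matrix of the `τ_a`, `b` is the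
second fundamental form of `r` at `p₀` with respect to the unit normal `n₀ = v₀/|v₀|`, and
`bᵐ_k = Σ_r b_{kr} ρʳᵐ`. -/
theorem operator_realized_by_second_form {n : ℕ} (hn : 3 ≤ n)
    (U : Set (Fin n → ℝ)) (hU : IsOpen U)
    (g : (Fin n → ℝ) → Matrix (Fin n) (Fin n) ℝ)
    (hsmooth : ∀ i j : Fin n, ContDiffOn ℝ (⊤ : ℕ∞) (fun x => g x i j) U)
    (hsym : ∀ x ∈ U, (g x).IsSymm)
    (hpos : ∀ x ∈ U, (g x).PosDef)
    (p₀ : Fin n → ℝ) (hp₀ : p₀ ∈ U)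
    (v₀ : Fin n → ℝ) (hv₀ : v₀ ≠ 0)
    -- `P` is the `g(p₀)`-orthogonal projection onto the hyperplane `α = {x | ⟨v₀, x⟩_g = 0}`:
    (P : (Fin n → ℝ) →ₗ[ℝ] (Fin n → ℝ))
    (hPrange : ∀ x : Fin n → ℝ, gInner (g p₀) v₀ (P x) = 0)
    (hPfix : ∀ x : Fin n → ℝ, gInner (g p₀) v₀ x = 0 → P x = x)
    (hPv₀ : P v₀ = 0)
    (H : (Fin n → ℝ) →ₗ[ℝ] (Fin n → ℝ))
    (hHsym : ∀ x y : Fin n → ℝ, gInner (g p₀) x (H y) = gInner (g p₀) (H x) y)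
    (hHP : H ∘ₗ P = H) (hPH : P ∘ₗ H = H) :
    ∃ W : Set (Fin (n - 1) → ℝ), IsOpen W ∧ (0 : Fin (n - 1) → ℝ) ∈ W ∧
      ∃ r : (Fin (n - 1) → ℝ) → (Fin n → ℝ),
        ContDiffOn ℝ (⊤ : ℕ∞) r W ∧
        r '' W ⊆ U ∧
        r 0 = p₀ ∧
        (∀ u ∈ W, LinearIndependent ℝ
          (fun a : Fin (n - 1) => fderiv ℝ r u (Pi.single a 1))) ∧
        ∃ τ : Fin (n - 1) → Fin n → ℝ,
          (∀ a : Fin (n - 1), τ a = fderiv ℝ r 0 (Pi.single a 1)) ∧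
          LinearIndependent ℝ τ ∧
          (∀ a : Fin (n - 1), gInner (g p₀) v₀ (τ a) = 0) ∧
          ∃ ρ : Matrix (Fin (n - 1)) (Fin (n - 1)) ℝ,
            (∀ a k : Fin (n - 1), ρ a k = gInner (g p₀) (τ a) (τ k)) ∧
            ∃ b : Matrix (Fin (n - 1)) (Fin (n - 1)) ℝ,
              (∀ k q : Fin (n - 1), b k q =
                gInner (g p₀)
                  (fun c => (Real.sqrt (gInner (g p₀) v₀ v₀))⁻¹ * v₀ c)
                  (fun c =>
                    fderiv ℝ (fun u => fderiv ℝ (fun u' => r u' c) u (Pi.single q 1)) 0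
                      (Pi.single k 1) +
                    ∑ d : Fin n, ∑ e : Fin n, christoffel g p₀ c d e * τ k d * τ q e)) ∧
              ∀ y : Fin n → ℝ, H y =
                ∑ m' : Fin (n - 1), ∑ a : Fin (n - 1), ∑ k : Fin (n - 1),
                  (gInner (g p₀) (τ a) y * ρ⁻¹ a k *
                    (∑ q : Fin (n - 1), b k q * ρ⁻¹ q m')) • τ m' := by
  set B := Matrix.toBilin' (g p₀)
  have hgB : ∀ x y, gInner (g p₀) x y = B x y := gInner_eq_toBilin' (g p₀)
  simp only [hgB] at hPrange hPfix hHsym ⊢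
  have hsymm : ∀ x y, B x y = B y x := fun x y => by
    rw [← hgB, ← hgB, gInner, gInner, Finset.sum_comm]
    refine Finset.sum_congr rfl fun i _ => Finset.sum_congr rfl fun j _ => ?_
    rw [(hsym p₀ hp₀).apply i j]
    ring
  have hBpos : ∀ x, x ≠ 0 → 0 < B x x := fun x hx => by
    have := (hpos p₀ hp₀).dotProduct_mulVec_pos hx
    rwa [star_trivial, ← Matrix.toBilin'_apply'] at this
  have hv₀pos := hBpos v₀ hv₀
  set s := Real.sqrt (B v₀ v₀) with hs
  have hspos : 0 < s := Real.sqrt_pos.2 hv₀pos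
  set n₀ : Fin n → ℝ := fun c => s⁻¹ * v₀ c with hn₀
  have hn₀v : n₀ = s⁻¹ • v₀ := rfl
  have hn₀unit : B n₀ n₀ = 1 := by
    rw [hn₀v, LinearMap.map_smul₂, map_smul, smul_eq_mul, smul_eq_mul,
      ← Real.mul_self_sqrt hv₀pos.le, ← hs]
    field_simp
  have hker : Module.finrank ℝ (LinearMap.ker (B v₀)) = n - 1 := by
    have hne : B v₀ ≠ 0 := fun h => hv₀pos.ne' (by rw [h, LinearMap.zero_apply])
    have := Module.Dual.finrank_ker_add_one_of_ne_zero (f := B v₀) hne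
    rw [Module.finrank_fin_fun] at this
    omega
  let bas := Module.finBasisOfFinrankEq ℝ (LinearMap.ker (B v₀)) hker
  let τ : Fin (n - 1) → Fin n → ℝ := fun a => bas a
  have hτ : LinearIndependent ℝ τ :=
    bas.linearIndependent.map' (LinearMap.ker (B v₀)).subtype (Submodule.ker_subtype _)
  have hτv : ∀ a, B v₀ (τ a) = 0 := fun a => (bas a).2
  have hspan : Submodule.span ℝ (Set.range τ) = LinearMap.ker (B v₀) := by
    have : Set.range τ = (LinearMap.ker (B v₀)).subtype '' Set.range bas := by
      rw [← Set.range_comp]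
      rfl
    rw [this, Submodule.span_image, bas.span_eq, Submodule.map_subtype_top]
  have hHrange : ∀ y, H y ∈ Submodule.span ℝ (Set.range τ) := fun y => by
    rw [hspan, LinearMap.mem_ker, ← hPH]
    exact hPrange _
  have hΓ : ∀ c d e, christoffel g p₀ c d e = christoffel g p₀ c e d :=
    christoffel_comm (Filter.eventually_of_mem (hU.mem_nhds hp₀) hsym)
  let Γ : (Fin n → ℝ) → (Fin n → ℝ) → Fin n → ℝ := fun x y c =>
    ∑ d, ∑ e, christoffel g p₀ c d e * x d * y e
  have hΓsymm : ∀ x y, Γ x y = Γ y x := fun x y => by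
    ext c
    simp only [Γ]
    rw [Finset.sum_comm]
    refine Finset.sum_congr rfl fun d _ => Finset.sum_congr rfl fun e _ => ?_
    rw [hΓ c e d]
    ring
  let C : Matrix (Fin (n - 1)) (Fin (n - 1)) ℝ := Matrix.of fun k q =>
    B (τ k) (H (τ q)) - B n₀ (Γ (τ k) (τ q))
  have hC : ∀ k q, C k q = C q k := fun k q => by
    simp only [C, Matrix.of_apply]
    rw [hΓsymm, hHsym, hsymm]
  let Q : (Fin (n - 1) → ℝ) →L[ℝ] (Fin (n - 1) → ℝ) →L[ℝ] ℝ :=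
    (Matrix.toBilin' C).toContinuousBilinearMap
  have hQ : ∀ x y, Q x y = Q y x := fun x y => by
    simp only [Q, LinearMap.toContinuousBilinearMap_apply, Matrix.toBilin'_apply]
    rw [Finset.sum_comm]
    refine Finset.sum_congr rfl fun i _ => Finset.sum_congr rfl fun j _ => ?_
    rw [hC]
    ring
  let L : (Fin (n - 1) → ℝ) →L[ℝ] Fin n → ℝ :=
    (Fintype.linearCombination ℝ τ).toContinuousLinearMap
  have hL : ∀ a, L (Pi.single a 1) = τ a := fun a => by
    simp [L, Fintype.linearCombination_apply_single]
  have hfderiv := hasFDerivAt_quadraticGraph p₀ L hQ n₀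
  have hsmoothr : ContDiff ℝ (⊤ : ℕ∞) (quadraticGraph p₀ L Q n₀) :=
    contDiff_quadraticGraph p₀ L Q n₀
  refine ⟨quadraticGraph p₀ L Q n₀ ⁻¹' U, hU.preimage hsmoothr.continuous, ?_,
    quadraticGraph p₀ L Q n₀, hsmoothr.contDiffOn, Set.image_preimage_subset _ _,
    quadraticGraph_zero p₀ L Q n₀, fun u _ => ?_, τ, fun a => ?_, hτ, hτv,
    Matrix.of fun a k => B (τ a) (τ k), fun _ _ => rfl,
    Matrix.of fun k q => B (τ k) (H (τ q)), fun k q => ?_,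
    symmetric_apply_eq_sum_gram_inv hsymm hBpos hτ hHsym hHrange⟩
  · rwa [Set.mem_preimage, quadraticGraph_zero]
  · refine LinearIndependent.of_comp P ?_
    convert hτ using 1
    ext1 a
    have hPn₀ : P n₀ = 0 := by rw [hn₀v, map_smul, hPv₀, smul_zero]
    simp [(hfderiv u).fderiv, hL, hPn₀, hPfix _ (hτv a)]
  · simp [(hfderiv 0).fderiv, hL]
  · have hsecond : (fun c => fderiv ℝ (fun u => fderiv ℝ
          (fun u' => quadraticGraph p₀ L Q n₀ u' c) u (Pi.single q 1)) 0 (Pi.single k 1) +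
        ∑ d, ∑ e, christoffel g p₀ c d e * τ k d * τ q e) =
        C k q • n₀ + Γ (τ k) (τ q) := by
      ext c
      rw [fderiv_fderiv_quadraticGraph_apply p₀ L hQ]
      simp only [Q, LinearMap.toContinuousBilinearMap_apply, Matrix.toBilin'_single]
      rfl
    rw [hsecond, map_add, map_smul, hn₀unit]
    simp [C]
end
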